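/- Let u_ε be a classical solution of the regularized isotropic problem with ε ∈ (0,ε₀], satisfying |u_ε| ≤ M and |∂_t u_ε| ≤ K on Q̄_T, where F = f(x,u,∇u) + f₀(x,u) with |f(x,u,z)| ≤ α|z|^{p̃+2} + β for positive constants α, β and a constant p̃ with −1 < p̃ < min_{Ω̄} p(x), and f₀ continuous and bounded on Ω̄×[−M,M]. Then there exists a constant C, independent of ε, such that max_{t∈[0,T]} ∫_Ω |∇u_ε(t,x)|^{p(x)+2} dx ≤ C. -/

import Mathlib

open Set Filter MeasureTheory Metric

noncomputable section

/-- The `i`-th partial derivative of a function on Euclidean space. -/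
def pd {n : ℕ} (f : EuclideanSpace ℝ (Fin n) → ℝ) (i : Fin n)
    (x : EuclideanSpace ℝ (Fin n)) : ℝ :=
  fderiv ℝ f x (EuclideanSpace.single i 1)

/-- The gradient vector of a function on Euclidean space. -/
def gradv {n : ℕ} (f : EuclideanSpace ℝ (Fin n) → ℝ)
    (x : EuclideanSpace ℝ (Fin n)) : EuclideanSpace ℝ (Fin n) :=
  (WithLp.equiv 2 (Fin n → ℝ)).symm (fun i => pd f i x)

/-- The exterior sphere condition for a domain. -/
def ExteriorSphereCond {n : ℕ} (Ω : Set (EuclideanSpace ℝ (Fin n))) : Prop :=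
  ∀ y ∈ frontier Ω, ∃ z r, 0 < r ∧ closedBall z r ∩ closure Ω = {y}

/-- `f` is of class `C^{1+γ}` on `s` (C¹ with γ-Hölder continuous derivative). -/
def C1HolderOn {n : ℕ} (γ : ℝ) (s : Set (EuclideanSpace ℝ (Fin n)))
    (f : EuclideanSpace ℝ (Fin n) → ℝ) : Prop :=
  ContDiffOn ℝ 1 f s ∧
    ∃ C : NNReal, HolderOnWith C γ.toNNReal (fun x => fderivWithin ℝ f s x) s

/-- Classical solution of the regularized isotropic problem
`u_t = div((|∇u|² + ε)^{p(x)/2} ∇u) + F(x, u, ∇u)` in `Q_T = (0,T) × Ω`,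
with `u = ψ` on `∂Ω × (0,T)` and `u(0,·) = u₀` in `Ω`. -/
structure IsClassicalSolIso {n : ℕ} (Ω : Set (EuclideanSpace ℝ (Fin n))) (T : ℝ)
    (p : EuclideanSpace ℝ (Fin n) → ℝ)
    (F : EuclideanSpace ℝ (Fin n) → ℝ → EuclideanSpace ℝ (Fin n) → ℝ)
    (ψ u₀ : EuclideanSpace ℝ (Fin n) → ℝ) (ε : ℝ)
    (u : ℝ → EuclideanSpace ℝ (Fin n) → ℝ) : Prop where
  cont : ContinuousOn (fun q : ℝ × EuclideanSpace ℝ (Fin n) => u q.1 q.2)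
      (Icc 0 T ×ˢ closure Ω)
  diff_t : ∀ t ∈ Ioo 0 T, ∀ x ∈ Ω, DifferentiableAt ℝ (fun s => u s x) t
  smooth_x : ∀ t ∈ Ioo 0 T, ∀ x ∈ Ω, ContDiffAt ℝ 2 (u t) x
  cont_ut : ContinuousOn
      (fun q : ℝ × EuclideanSpace ℝ (Fin n) => deriv (fun s => u s q.2) q.1) (Ioo 0 T ×ˢ Ω)
  cont_ux : ∀ i, ContinuousOn
      (fun q : ℝ × EuclideanSpace ℝ (Fin n) => pd (u q.1) i q.2) (Ioo 0 T ×ˢ Ω)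
  cont_uxx : ∀ i j, ContinuousOn
      (fun q : ℝ × EuclideanSpace ℝ (Fin n) => pd (fun y => pd (u q.1) j y) i q.2)
      (Ioo 0 T ×ˢ Ω)
  eqn : ∀ t ∈ Ioo 0 T, ∀ x ∈ Ω,
      deriv (fun s => u s x) t =
        (∑ i, pd (fun y => (‖gradv (u t) y‖ ^ 2 + ε) ^ (p y / 2) * pd (u t) i y) i x)
          + F x (u t x) (gradv (u t) x)
  bdry : ∀ t ∈ Ioo 0 T, ∀ x ∈ frontier Ω, u t x = ψ x
  init : ∀ x ∈ closure Ω, u 0 x = u₀ x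

/-- A `C¹` truncation of the identity that vanishes near the origin. -/
lemma exists_truncation {δ : ℝ} (hδ : 0 < δ) :
    ∃ φ h : ℝ → ℝ, Continuous h ∧ (∀ s, HasDerivAt φ (h s) s) ∧ (∀ s, 0 ≤ h s) ∧
      (∀ s, h s ≤ 1) ∧ (∀ s, |s| ≤ δ → φ s = 0) ∧ (∀ s, 2 * δ ≤ |s| → h s = 1) ∧
      (∀ s, |φ s| ≤ |s| * h s) := by
  set h : ℝ → ℝ := fun s => min 1 (max 0 (|s| / δ - 1)) with hh
  have hc : Continuous h := by fun_prop
  have h0 : ∀ s, 0 ≤ h s := fun s => le_min zero_le_one (le_max_left _ _)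
  have hmono : ∀ x s, |x| ≤ |s| → h x ≤ h s := by
    intro x s hx
    simp only [hh]
    gcongr
  have key : ∀ s, |∫ x in (0 : ℝ)..s, h x| ≤ |s| * h s := by
    intro s
    have := intervalIntegral.norm_integral_le_of_norm_le_const (a := (0 : ℝ)) (b := s)
      (f := h) (C := h s) (by
        intro x hx
        rw [Real.norm_of_nonneg (h0 x)]
        apply hmono
        rcases le_total 0 s with hs | hs
        · rw [uIoc_of_le hs] at hx
          rw [abs_of_pos hx.1, abs_of_nonneg hs]; exact hx.2
        · rw [uIoc_of_ge hs] at hx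
          rw [abs_of_nonpos hx.2, abs_of_nonpos hs]; linarith [hx.1])
    rw [sub_zero, Real.norm_eq_abs] at this
    linarith
  refine ⟨fun s => ∫ x in (0 : ℝ)..s, h x, h, hc,
    fun s => (hc.integral_hasStrictDerivAt 0 s).hasDerivAt, h0, fun s => min_le_left _ _,
    ?_, ?_, key⟩
  · intro s hs
    have : h s = 0 := by
      simp only [hh]
      have : |s| / δ ≤ 1 := (div_le_one hδ).2 hs
      rw [max_eq_left (by linarith)]; simp
    have k := key s
    rw [this, mul_zero] at k
    exact abs_nonpos_iff.1 k
  · intro s hs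
    have : 2 ≤ |s| / δ := (le_div_iff₀ hδ).2 hs
    simp only [hh]
    rw [max_eq_right (by linarith), min_eq_left (by linarith)]

/-- Coercivity of the regularized flux, uniformly in the regularization parameter. -/
lemma exists_coercivity {η P pt G a ε₀ : ℝ} (hη : 0 < η) (hpt : -1 < pt) (hG : 0 ≤ G)
    (ha : 0 ≤ a) (hε₀ : 0 < ε₀) :
    ∃ c C : ℝ, 0 < c ∧ 0 ≤ C ∧ ∀ q r ε : ℝ, -1 + η ≤ q → q ≤ P → pt + η ≤ q → 0 < ε →
      ε ≤ ε₀ → 0 ≤ r →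
      c * r ^ (q + 2) ≤ (r ^ 2 + ε) ^ (q / 2) * r ^ 2 - G * ((r ^ 2 + ε) ^ (q / 2) * r)
        - a * r ^ (pt + 2) + C := by
  set b : ℝ := (1 + ε₀) ^ (-(1 / 2) : ℝ) with hb
  have hbpos : 0 < b := by positivity
  obtain ⟨R, hR1, hR2, hR3⟩ : ∃ R : ℝ, 1 ≤ R ∧ 2 * G ≤ R ∧ 4 * a / b ≤ R ^ η :=
    (((eventually_ge_atTop 1).and ((eventually_ge_atTop (2 * G)).and
      ((tendsto_rpow_atTop hη).eventually_ge_atTop (4 * a / b))))).exists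
  refine ⟨b / 4, b / 4 * R ^ (P + 2) + G * (R ^ 2 + ε₀) ^ ((P + 1) / 2) + a * R ^ (pt + 2),
    by positivity, by positivity, ?_⟩
  intro q r ε hq1 hqP hqpt hε hεε hr
  have hE : 0 ≤ (r ^ 2 + ε) ^ (q / 2) := by positivity
  rcases lt_or_ge r R with hrR | hrR
  · have h1 : r ^ (q + 2) ≤ R ^ (P + 2) :=
      (Real.rpow_le_rpow hr hrR.le (by linarith)).trans
        (Real.rpow_le_rpow_of_exponent_le hR1 (by linarith))
    have h2 : (r ^ 2 + ε) ^ (q / 2) * r ≤ (R ^ 2 + ε₀) ^ ((P + 1) / 2) := by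
      have hs : r ≤ (r ^ 2 + ε) ^ (1 / 2 : ℝ) := by
        rw [← Real.sqrt_eq_rpow]
        exact Real.le_sqrt_of_sq_le (by linarith)
      calc (r ^ 2 + ε) ^ (q / 2) * r ≤ (r ^ 2 + ε) ^ (q / 2) * (r ^ 2 + ε) ^ (1 / 2 : ℝ) := by
            gcongr
        _ = (r ^ 2 + ε) ^ ((q + 1) / 2) := by
            rw [← Real.rpow_add (by positivity)]; congr 1; ring
        _ ≤ (R ^ 2 + ε₀) ^ ((q + 1) / 2) := by
            apply Real.rpow_le_rpow (by positivity) _ (by linarith)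
            gcongr
        _ ≤ _ := by
            apply Real.rpow_le_rpow_of_exponent_le _ (by linarith)
            nlinarith
    have h3 : r ^ (pt + 2) ≤ R ^ (pt + 2) := Real.rpow_le_rpow hr hrR.le (by linarith)
    have h4 : 0 ≤ (r ^ 2 + ε) ^ (q / 2) * r ^ 2 := by positivity
    have h5 := mul_le_mul_of_nonneg_left h1 (by positivity : (0:ℝ) ≤ b / 4)
    have h6 := mul_le_mul_of_nonneg_left h2 hG
    have h7 := mul_le_mul_of_nonneg_left h3 ha
    linarith
  · have hr0 : 0 < r := by linarith
    have h1 : G * ((r ^ 2 + ε) ^ (q / 2) * r) ≤ 1 / 2 * ((r ^ 2 + ε) ^ (q / 2) * r ^ 2) := by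
      have : G ≤ r / 2 := by linarith
      calc G * ((r ^ 2 + ε) ^ (q / 2) * r) ≤ r / 2 * ((r ^ 2 + ε) ^ (q / 2) * r) := by gcongr
        _ = _ := by ring
    have h2 : b * r ^ (q + 2) ≤ (r ^ 2 + ε) ^ (q / 2) * r ^ 2 := by
      have e1 : (r ^ 2 + ε) ^ (q / 2)
          = (r ^ 2 + ε) ^ ((q + 1) / 2) * (r ^ 2 + ε) ^ (-(1 / 2) : ℝ) := by
        rw [← Real.rpow_add (by positivity)]; congr 1; ring
      have e2 : (r ^ 2) ^ ((q + 1) / 2) ≤ (r ^ 2 + ε) ^ ((q + 1) / 2) :=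
        Real.rpow_le_rpow (by positivity) (by linarith) (by linarith)
      have e3 : ((1 + ε₀) * r ^ 2) ^ (-(1 / 2) : ℝ) ≤ (r ^ 2 + ε) ^ (-(1 / 2) : ℝ) := by
        apply Real.rpow_le_rpow_of_nonpos (by positivity) _ (by norm_num)
        nlinarith [mul_le_mul hεε (show 1 ≤ r ^ 2 by nlinarith) zero_le_one hε₀.le]
      have e4 : b * r ^ (q + 2)
          = (r ^ 2) ^ ((q + 1) / 2) * ((1 + ε₀) * r ^ 2) ^ (-(1 / 2) : ℝ) * r ^ 2 := by
        rw [Real.mul_rpow (by positivity) (by positivity), ← hb,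
          ← Real.rpow_natCast r 2, ← Real.rpow_mul hr, ← Real.rpow_mul hr]
        rw [show r ^ ((2:ℕ) * ((q + 1) / 2)) * (b * r ^ ((2:ℕ) * (-(1 / 2) : ℝ))) * r ^ ((2:ℕ):ℝ)
          = b * (r ^ ((2:ℕ) * ((q + 1) / 2)) * r ^ ((2:ℕ) * (-(1 / 2) : ℝ)) * r ^ ((2:ℕ):ℝ)) by ring,
          ← Real.rpow_add hr0, ← Real.rpow_add hr0]
        congr 2
        push_cast
        ring
      rw [e4, e1]
      gcongr
    have h3 : a * r ^ (pt + 2) ≤ b / 4 * r ^ (q + 2) := by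
      have e1 : r ^ (pt + 2) * r ^ η ≤ r ^ (q + 2) := by
        rw [← Real.rpow_add hr0]
        exact Real.rpow_le_rpow_of_exponent_le (by linarith) (by linarith)
      have e2 : R ^ η ≤ r ^ η := Real.rpow_le_rpow (by linarith) hrR hη.le
      have e3 : a ≤ b / 4 * r ^ η := by
        have := (div_le_iff₀ hbpos).1 (hR3.trans e2)
        linarith
      calc a * r ^ (pt + 2) ≤ b / 4 * r ^ η * r ^ (pt + 2) := by gcongr
        _ = b / 4 * (r ^ (pt + 2) * r ^ η) := by ring
        _ ≤ _ := by gcongr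
    have h4 : 0 ≤ b / 4 * R ^ (P + 2) + G * (R ^ 2 + ε₀) ^ ((P + 1) / 2) + a * R ^ (pt + 2) := by
      positivity
    linarith

/-- The integral of a partial derivative of a compactly supported `C¹` function vanishes. -/
lemma integral_pd_eq_zero {n : ℕ} {F : EuclideanSpace ℝ (Fin n) → ℝ} (hF : ContDiff ℝ 1 F)
    (hc : HasCompactSupport F) (i : Fin n) :
    Integrable (pd F i) ∧ ∫ x, pd F i x = 0 := by
  have hcont : Continuous (pd F i) := by
    unfold pd
    exact (hF.continuous_fderiv one_ne_zero).clm_apply continuous_const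
  have hint : Integrable (pd F i) :=
    hcont.integrable_of_hasCompactSupport (hc.fderiv_apply (𝕜 := ℝ) _)
  refine ⟨hint, ?_⟩
  have := integral_mul_fderiv_eq_neg_fderiv_mul_of_integrable (μ := volume)
    (f := fun _ : EuclideanSpace ℝ (Fin n) => (1 : ℝ)) (g := F)
    (v := EuclideanSpace.single i 1) (by simp) (by simp only [one_mul]; exact hint)
    (by simpa using hF.continuous.integrable_of_hasCompactSupport hc)
    (fun x _ => by fun_prop) (fun x _ => (hF.differentiable one_ne_zero) x)
  simp only [one_mul, fderiv_fun_const, Pi.zero_apply, zero_apply, zero_mul,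
    integral_zero, neg_zero] at this
  exact this

/-- Divergence theorem for a field multiplied by a truncation of a function vanishing on the
boundary. -/
lemma setIntegral_pd_truncation_mul {n : ℕ} {Ω : Set (EuclideanSpace ℝ (Fin n))}
    (hΩo : IsOpen Ω) (hΩbd : Bornology.IsBounded Ω) {w X : EuclideanSpace ℝ (Fin n) → ℝ}
    (hwc : ContinuousOn w (closure Ω)) (hw : ∀ x ∈ Ω, ContDiffAt ℝ 1 w x)
    (hw0 : ∀ x ∈ frontier Ω, w x = 0) (hX : ∀ x ∈ Ω, ContDiffAt ℝ 1 X x)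
    {φ : ℝ → ℝ} (hφ : ContDiff ℝ 1 φ) {δ : ℝ} (hδ : 0 < δ) (hφ0 : ∀ s, |s| ≤ δ → φ s = 0)
    (i : Fin n) :
    IntegrableOn (pd (fun y => φ (w y) * X y) i) Ω ∧
      ∫ x in Ω, pd (fun y => φ (w y) * X y) i x = 0 := by
  set S : Set (EuclideanSpace ℝ (Fin n)) := closure Ω ∩ {x | δ ≤ |w x|} with hS
  have hScl : IsClosed S := by
    have := (hwc.abs).preimage_isClosed_of_isClosed isClosed_closure (isClosed_Ici (a := δ))
    exact this
  have hScomp : IsCompact S := hΩbd.isCompact_closure.of_isClosed_subset hScl inter_subset_left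
  have hSΩ : S ⊆ Ω := by
    rintro x ⟨hx, hx2⟩
    by_contra hxΩ
    have : x ∈ frontier Ω := by
      rw [frontier, hΩo.interior_eq]; exact ⟨hx, hxΩ⟩
    simp only [mem_ofPred_eq, hw0 x this, abs_zero] at hx2
    linarith
  set F : EuclideanSpace ℝ (Fin n) → ℝ := Ω.indicator (fun y => φ (w y) * X y) with hFdef
  have hF0 : ∀ x ∉ S, F x = 0 := by
    intro x hx
    by_cases hxΩ : x ∈ Ω
    · have : |w x| ≤ δ := by
        by_contra hcon
        exact hx ⟨subset_closure hxΩ, (not_le.1 hcon).le⟩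
      simp [hFdef, hxΩ, hφ0 _ this]
    · simp [hFdef, hxΩ]
  have hFeq : ∀ x ∈ Ω, F =ᶠ[nhds x] fun y => φ (w y) * X y := by
    intro x hx
    filter_upwards [hΩo.mem_nhds hx] with y hy
    simp [hFdef, hy]
  have hF : ContDiff ℝ 1 F := by
    rw [contDiff_iff_contDiffAt]
    intro x
    by_cases hx : x ∈ Ω
    · exact ((hφ.contDiffAt.comp x (hw x hx)).mul (hX x hx)).congr_of_eventuallyEq (hFeq x hx)
    · have : F =ᶠ[nhds x] fun _ => 0 := by
        filter_upwards [hScl.isOpen_compl.mem_nhds (fun h => hx (hSΩ h))] with y hy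
        exact hF0 y hy
      exact contDiffAt_const.congr_of_eventuallyEq this
  have hFc : HasCompactSupport F := HasCompactSupport.intro hScomp hF0
  have hpd : EqOn (pd F i) (pd (fun y => φ (w y) * X y) i) Ω := by
    intro x hx
    simp only [pd]
    rw [(hFeq x hx).fderiv_eq]
  have hpd0 : ∀ x, x ∉ Ω → pd F i x = 0 := by
    intro x hx
    have : F =ᶠ[nhds x] fun _ => 0 := by
      filter_upwards [hScl.isOpen_compl.mem_nhds (fun h => hx (hSΩ h))] with y hy
      exact hF0 y hy
    simp only [pd]
    rw [this.fderiv_eq]; simp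
  obtain ⟨h1, h2⟩ := integral_pd_eq_zero hF hFc i
  refine ⟨h1.integrableOn.congr_fun hpd hΩo.measurableSet, ?_⟩
  rw [← setIntegral_congr_fun hΩo.measurableSet hpd,
    setIntegral_eq_integral_of_forall_compl_eq_zero hpd0, h2]

lemma gradv_apply {n : ℕ} (f : EuclideanSpace ℝ (Fin n) → ℝ) (x : EuclideanSpace ℝ (Fin n))
    (i : Fin n) : gradv f x i = pd f i x := rfl

lemma norm_gradv_sq {n : ℕ} (f : EuclideanSpace ℝ (Fin n) → ℝ) (x : EuclideanSpace ℝ (Fin n)) :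
    ‖gradv f x‖ ^ 2 = ∑ i, pd f i x * pd f i x := by
  rw [EuclideanSpace.norm_sq_eq]
  refine Finset.sum_congr rfl fun i _ => ?_
  rw [gradv_apply, Real.norm_eq_abs, sq_abs, sq]

lemma sum_pd_mul_pd_le {n : ℕ} (f g : EuclideanSpace ℝ (Fin n) → ℝ)
    (x : EuclideanSpace ℝ (Fin n)) :
    ∑ i, pd g i x * pd f i x ≤ ‖gradv g x‖ * ‖gradv f x‖ := by
  have h := real_inner_le_norm (gradv f x) (gradv g x)
  rw [PiLp.inner_apply] at h
  rw [mul_comm]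
  refine le_trans (le_of_eq ?_) h
  exact Finset.sum_congr rfl fun i _ => by simp [gradv_apply]

lemma ContDiffAt.pd {n : ℕ} {f : EuclideanSpace ℝ (Fin n) → ℝ} {x : EuclideanSpace ℝ (Fin n)}
    (hf : ContDiffAt ℝ 2 f x) (i : Fin n) : ContDiffAt ℝ 1 (fun y => pd f i y) x := by
  have h : ContDiffAt ℝ 1 (fderiv ℝ f) x := hf.fderiv_right (m := 1) (by norm_num)
  exact h.clm_apply contDiffAt_const

lemma ContDiffAt.gradv {n : ℕ} {f : EuclideanSpace ℝ (Fin n) → ℝ}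
    {x : EuclideanSpace ℝ (Fin n)} (hf : ContDiffAt ℝ 2 f x) :
    ContDiffAt ℝ 1 (fun y => gradv f y) x := by
  rw [contDiffAt_euclidean]
  exact fun i => hf.pd i

/-- The energy estimate away from the coincidence set of `v` and a comparison function `g` with
the same boundary values. -/
lemma setLIntegral_norm_gradv_rpow_le {n : ℕ} {Ω : Set (EuclideanSpace ℝ (Fin n))}
    (hΩo : IsOpen Ω) (hΩbd : Bornology.IsBounded Ω) {v g p : EuclideanSpace ℝ (Fin n) → ℝ}
    (hvc : ContinuousOn v (closure Ω)) (hv : ∀ x ∈ Ω, ContDiffAt ℝ 2 v x)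
    (hgc : ContinuousOn g (closure Ω)) (hg : ∀ x ∈ Ω, ContDiffAt ℝ 1 g x)
    (hp : ∀ x ∈ Ω, ContDiffAt ℝ 1 p x) (hvg : ∀ x ∈ frontier Ω, v x = g x)
    {G m ε α B c C pt : ℝ} (hG : ∀ x ∈ Ω, ‖gradv g x‖ ≤ G) (hm0 : 0 ≤ m)
    (hm : ∀ x ∈ Ω, |v x - g x| ≤ m)
    (hε : 0 < ε) (hB : 0 ≤ B) (hc : 0 < c) (hC : 0 ≤ C)
    (hdiv : ∀ x ∈ Ω,
      |∑ i, pd (fun y => (‖gradv v y‖ ^ 2 + ε) ^ (p y / 2) * pd v i y) i x|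
        ≤ α * ‖gradv v x‖ ^ (pt + 2) + B)
    (hcoer : ∀ x ∈ Ω, ∀ r : ℝ, 0 ≤ r → c * r ^ (p x + 2) ≤
      (r ^ 2 + ε) ^ (p x / 2) * r ^ 2 - G * ((r ^ 2 + ε) ^ (p x / 2) * r)
        - (m * α) * r ^ (pt + 2) + C) :
    ∫⁻ x in Ω ∩ {x | v x ≠ g x}, ENNReal.ofReal (‖gradv v x‖ ^ (p x + 2))
      ≤ ENNReal.ofReal ((C + m * B) / c * volume.real Ω) := by
  set X : Fin n → EuclideanSpace ℝ (Fin n) → ℝ :=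
    fun i y => (‖gradv v y‖ ^ 2 + ε) ^ (p y / 2) * pd v i y with hXdef
  have hX : ∀ i, ∀ x ∈ Ω, ContDiffAt ℝ 1 (X i) x := by
    intro i x hx
    have h1 : ContDiffAt ℝ 1 (fun y => ‖gradv v y‖ ^ 2 + ε) x :=
      ((hv x hx).gradv.norm_sq ℝ).add contDiffAt_const
    have h2 : ContDiffAt ℝ 1 (fun y => p y / 2) x := (hp x hx).div_const 2
    exact (h1.rpow h2 (by positivity)).mul ((hv x hx).pd i)
  have hw : ∀ x ∈ Ω, ContDiffAt ℝ 1 (fun y => v y - g y) x := fun x hx =>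
    ((hv x hx).of_le (by norm_num)).sub (hg x hx)
  have key : ∀ k : ℕ, ∃ D : EuclideanSpace ℝ (Fin n) → ℝ, IntegrableOn D Ω ∧
      (∫ x in Ω, D x = 0) ∧ (∀ x ∈ Ω, 0 ≤ C + m * B + D x) ∧
      ∀ x ∈ Ω, 2 * (1 / ((k : ℝ) + 1)) ≤ |v x - g x| →
        c * ‖gradv v x‖ ^ (p x + 2) ≤ C + m * B + D x := by
    intro k
    have hδ : 0 < 1 / ((k : ℝ) + 1) := by positivity
    obtain ⟨φ, h, hhc, hφd, hh0, hh1, hφ0, hh2, hφh⟩ := exists_truncation hδ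
    have hφ : ContDiff ℝ 1 φ := by
      rw [contDiff_one_iff_deriv]
      refine ⟨fun s => (hφd s).differentiableAt, ?_⟩
      rwa [show deriv φ = h from funext fun s => (hφd s).deriv]
    have hdv := fun i => setIntegral_pd_truncation_mul hΩo hΩbd
      (w := fun y => v y - g y) (hvc.sub hgc) hw
      (fun x hx => by rw [hvg x hx, sub_self]) (hX i) hφ hδ hφ0 i
    have hpt : ∀ x ∈ Ω, h (v x - g x) * (c * ‖gradv v x‖ ^ (p x + 2)) ≤
        h (v x - g x) * (C + m * B) +
          ∑ i, pd (fun y => φ (v y - g y) * X i y) i x := by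
      intro x hx
      set s := v x - g x with hs
      set r := ‖gradv v x‖ with hr
      set E := (r ^ 2 + ε) ^ (p x / 2) with hE
      have hE0 : 0 ≤ E := by positivity
      have e1 : ∀ i, pd (fun y => φ (v y - g y) * X i y) i x =
          h s * ((pd v i x - pd g i x) * X i x) + φ s * pd (X i) i x := by
        intro i
        have d1 : HasFDerivAt (fun y => v y - g y) (fderiv ℝ v x - fderiv ℝ g x) x :=
          (((hv x hx).differentiableAt (by norm_num)).hasFDerivAt).sub
            (((hg x hx).differentiableAt (by norm_num)).hasFDerivAt)
        have d2 : HasFDerivAt (fun y => φ (v y - g y)) (h s • (fderiv ℝ v x - fderiv ℝ g x)) x :=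
          (hφd s).comp_hasFDerivAt x d1
        have d3 := d2.mul (((hX i x hx).differentiableAt (by norm_num)).hasFDerivAt)
        simp only [pd]
        erw [d3.fderiv]
        simp
        ring
      have e2 : ∑ i, (pd v i x - pd g i x) * X i x
          = E * r ^ 2 - E * ∑ i, pd g i x * pd v i x := by
        rw [hr, norm_gradv_sq, Finset.mul_sum, Finset.mul_sum, ← Finset.sum_sub_distrib]
        refine Finset.sum_congr rfl fun i _ => ?_
        simp only [hXdef, hE, hr]
        ring
      simp_rw [e1]
      rw [Finset.sum_add_distrib, ← Finset.mul_sum, ← Finset.mul_sum, e2]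
      have e3 : E * ∑ i, pd g i x * pd v i x ≤ G * (E * r) := by
        calc E * ∑ i, pd g i x * pd v i x ≤ E * (‖gradv g x‖ * r) := by
              gcongr; exact sum_pd_mul_pd_le v g x
          _ ≤ E * (G * r) := by gcongr; exact hG x hx
          _ = _ := by ring
      have e4 : -(h s * (m * α * r ^ (pt + 2) + m * B)) ≤ φ s * ∑ i, pd (X i) i x := by
        have a1 : |φ s * ∑ i, pd (X i) i x| ≤ (m * h s) * (α * r ^ (pt + 2) + B) := by
          rw [abs_mul]
          have := hh0 s
          apply mul_le_mul _ (hdiv x hx) (abs_nonneg _) (by positivity)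
          exact (hφh s).trans (mul_le_mul_of_nonneg_right (hm x hx) this)
        have := (abs_le.1 a1).1
        linarith
      have e5 := mul_le_mul_of_nonneg_left (hcoer x hx r (norm_nonneg _)) (hh0 s)
      have e6 := mul_le_mul_of_nonneg_left e3 (hh0 s)
      linarith
    refine ⟨fun x => ∑ i, pd (fun y => φ (v y - g y) * X i y) i x,
      integrable_finsetSum _ fun i _ => (hdv i).1, ?_, ?_, ?_⟩
    · beta_reduce
      rw [integral_finsetSum _ fun i _ => (hdv i).1]
      exact Finset.sum_eq_zero fun i _ => (hdv i).2
    · intro x hx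
      have := hpt x hx
      have h1 : 0 ≤ h (v x - g x) * (c * ‖gradv v x‖ ^ (p x + 2)) :=
        mul_nonneg (hh0 _) (by positivity)
      have h2 : h (v x - g x) * (C + m * B) ≤ 1 * (C + m * B) :=
        mul_le_mul_of_nonneg_right (hh1 _) (by positivity)
      linarith
    · intro x hx hx2
      have := hpt x hx
      rw [hh2 _ hx2] at this
      linarith
  choose D hDi hD0 hDn hDl using key
  have hopen : IsOpen (Ω ∩ {x | v x ≠ g x}) := by
    have : ContinuousOn (fun x => v x - g x) Ω := (hvc.sub hgc).mono subset_closure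
    have := this.isOpen_inter_preimage hΩo (isOpen_compl_singleton (x := (0:ℝ)))
    convert this using 2
    ext x; simp [sub_eq_zero]
  have hvol : volume Ω ≠ ⊤ := hΩbd.measure_lt_top.ne
  calc ∫⁻ x in Ω ∩ {x | v x ≠ g x}, ENNReal.ofReal (‖gradv v x‖ ^ (p x + 2))
      ≤ ∫⁻ x in Ω ∩ {x | v x ≠ g x},
          liminf (fun k => ENNReal.ofReal ((C + m * B + D k x) / c)) atTop := by
        refine setLIntegral_mono' hopen.measurableSet ?_
        rintro x ⟨hx, hne⟩
        have hpos : 0 < |v x - g x| := abs_pos.2 (sub_ne_zero.2 hne)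
        have hlim : Tendsto (fun k : ℕ => 2 * (1 / ((k : ℝ) + 1))) atTop (nhds (2 * 0)) :=
          tendsto_one_div_add_atTop_nhds_zero_nat.const_mul 2
        rw [mul_zero] at hlim
        refine le_liminf_of_le (by isBoundedDefault) ?_
        filter_upwards [hlim.eventually (gt_mem_nhds hpos)] with k hk
        apply ENNReal.ofReal_le_ofReal
        rw [le_div_iff₀ hc, mul_comm]
        exact hDl k x hx hk.le
    _ ≤ ∫⁻ x in Ω, liminf (fun k => ENNReal.ofReal ((C + m * B + D k x) / c)) atTop :=
        lintegral_mono_set inter_subset_left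
    _ ≤ liminf (fun k => ∫⁻ x in Ω, ENNReal.ofReal ((C + m * B + D k x) / c)) atTop := by
        apply lintegral_liminf_le'
        intro k
        exact (((hDi k).aemeasurable.const_add _).div_const _).ennreal_ofReal
    _ = ENNReal.ofReal ((C + m * B) / c * volume.real Ω) := by
        have : ∀ k, ∫⁻ x in Ω, ENNReal.ofReal ((C + m * B + D k x) / c)
            = ENNReal.ofReal ((C + m * B) / c * volume.real Ω) := by
          intro k
          have hi : IntegrableOn (fun x => C + m * B + D k x) Ω :=
            (integrableOn_const hvol).add (hDi k)
          rw [← ofReal_integral_eq_lintegral_ofReal (hi.div_const c)]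
          · rw [integral_div, integral_add (integrable_const_iff.2 (.inr ⟨by simpa using hvol.lt_top⟩))
              (hDi k), hD0 k]
            simp
            ring_nf
          · filter_upwards [ae_restrict_mem hΩo.measurableSet] with x hx
            exact div_nonneg (hDn k x hx) hc.le
        simp_rw [this]
        simp

/-- Jensen's inequality for powers on the unit interval. -/
lemma ofReal_abs_intervalIntegral_rpow_le {f : ℝ → ℝ} (hf : ContinuousOn f (Icc 0 1)) {r : ℝ}
    (hr : 1 ≤ r) :
    ENNReal.ofReal (|∫ s in (0 : ℝ)..1, f s| ^ r)
      ≤ ∫⁻ s in Icc (0 : ℝ) 1, ENNReal.ofReal (|f s| ^ r) := by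
  have : IsProbabilityMeasure (volume.restrict (Icc (0 : ℝ) 1)) := ⟨by simp⟩
  have hr0 : 0 ≤ r := by linarith
  have h1 : ContinuousOn (fun s => |f s|) (Icc 0 1) := hf.abs
  have h2 : ContinuousOn (fun s => |f s| ^ r) (Icc 0 1) := h1.rpow_const fun _ _ => .inr hr0
  have h3 := (convexOn_rpow hr).map_integral_le (μ := volume.restrict (Icc (0 : ℝ) 1))
    (f := fun s => |f s|) (continuousOn_id.rpow_const fun _ _ => .inr hr0) isClosed_Ici
    (Filter.Eventually.of_forall fun s => abs_nonneg (f s)) h1.integrableOn_Icc h2.integrableOn_Icc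
  rw [← ofReal_integral_eq_lintegral_ofReal h2.integrableOn_Icc
    (Filter.Eventually.of_forall fun s => by positivity)]
  apply ENNReal.ofReal_le_ofReal
  refine le_trans ?_ h3
  apply Real.rpow_le_rpow (abs_nonneg _) _ hr0
  rw [intervalIntegral.integral_of_le zero_le_one, ← integral_Icc_eq_integral_Ioc]
  exact abs_integral_le_integral_abs

lemma ofReal_abs_slope_rpow_le {n : ℕ} {v : EuclideanSpace ℝ (Fin n) → ℝ} {i : Fin n}
    {x : EuclideanSpace ℝ (Fin n)} {h r : ℝ} (hh : 0 < h) (hr : 1 ≤ r)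
    (hv : ∀ s ∈ Icc (0 : ℝ) 1, ContDiffAt ℝ 2 v (x + (s * h) • EuclideanSpace.single i 1)) :
    ENNReal.ofReal (|(v (x + h • EuclideanSpace.single i 1) - v x) / h| ^ r)
      ≤ ∫⁻ s in Icc (0 : ℝ) 1,
          ENNReal.ofReal (|pd v i (x + (s * h) • EuclideanSpace.single i 1)| ^ r) := by
  set e : EuclideanSpace ℝ (Fin n) := EuclideanSpace.single i 1 with he
  have hc : ContinuousOn (fun s : ℝ => pd v i (x + (s * h) • e)) (Icc 0 1) := by
    intro s hs
    have h1 : ContinuousAt (fun y => pd v i y) (x + (s * h) • e) := ((hv s hs).pd i).continuousAt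
    have h2 : ContinuousAt (fun s : ℝ => x + (s * h) • e) s := by fun_prop
    exact (ContinuousAt.comp (f := fun s : ℝ => x + (s * h) • e) h1 h2).continuousWithinAt
  have hint : (∫ s in (0 : ℝ)..1, pd v i (x + (s * h) • e)) = (v (x + h • e) - v x) / h := by
    have hd : ∀ s ∈ uIcc (0 : ℝ) 1, HasDerivAt (fun s => v (x + (s * h) • e) / h)
        (pd v i (x + (s * h) • e)) s := by
      intro s hs
      rw [uIcc_of_le zero_le_one] at hs
      have h1 := ((hv s hs).differentiableAt (by norm_num)).hasFDerivAt
      have h2 : HasDerivAt (fun s : ℝ => x + (s * h) • e) (h • e) s := by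
        simpa using (((hasDerivAt_id s).mul_const h).smul_const e).const_add x
      have h3 := (h1.comp_hasDerivAt s h2).div_const h
      refine h3.congr_deriv ?_
      rw [map_smul, smul_eq_mul, mul_div_cancel_left₀ _ hh.ne']
      rfl
    rw [intervalIntegral.integral_eq_sub_of_hasDerivAt hd
      (hc.intervalIntegrable_of_Icc zero_le_one)]
    simp only [one_mul, zero_mul, zero_smul, add_zero]
    ring
  rw [← hint]
  exact ofReal_abs_intervalIntegral_rpow_le hc hr

/-- A bound for the modular of the gradient passes to uniform limits, for each partial
derivative. -/
lemma setLIntegral_pd_rpow_le_of_approx {n : ℕ} {Ω : Set (EuclideanSpace ℝ (Fin n))}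
    (hΩo : IsOpen Ω) (hΩbd : Bornology.IsBounded Ω) {u p : EuclideanSpace ℝ (Fin n) → ℝ}
    (hp : ContinuousOn p (closure Ω)) {η : ℝ} (hη : 0 < η) (hpη : ∀ x ∈ closure Ω, -1 + η ≤ p x)
    {D : ENNReal}
    (happ : ∀ κ : ℝ, 0 < κ → ∃ v : EuclideanSpace ℝ (Fin n) → ℝ,
      (∀ x ∈ Ω, ContDiffAt ℝ 2 v x) ∧ (∀ x ∈ Ω, |v x - u x| ≤ κ) ∧
      ∫⁻ x in Ω, ENNReal.ofReal (‖gradv v x‖ ^ (p x + 2)) ≤ D) (i : Fin n) :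
    ∫⁻ x in Ω, ENNReal.ofReal (|pd u i x| ^ (p x + 2)) ≤ volume Ω + D := by
  classical
  set e : EuclideanSpace ℝ (Fin n) := EuclideanSpace.single i 1 with he
  have hnorm : ‖e‖ = 1 := by simp [he]
  have huc := hΩbd.isCompact_closure.uniformContinuousOn_of_continuous hp
  rw [Metric.uniformContinuousOn_iff] at huc
  have hex : ∀ j : ℕ, ∃ h : ℝ, 0 < h ∧ h ≤ 1 / ((j : ℝ) + 1) ∧ ∀ x ∈ closure Ω,
      ∀ y ∈ closure Ω, dist x y ≤ h → |p x - p y| ≤ η * (1 / ((j : ℝ) + 1)) := by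
    intro j
    obtain ⟨d, hd, hd2⟩ := huc (η * (1 / ((j : ℝ) + 1))) (by positivity)
    refine ⟨min (d / 2) (1 / ((j : ℝ) + 1)), by positivity, min_le_right _ _, ?_⟩
    intro x hx y hy hxy
    have : dist x y < d := by
      have := hxy.trans (min_le_left _ _); linarith
    exact (hd2 x hx y hy this).le
  choose h hh0 hh1 hhp using hex
  choose v hv hvu hvD using fun j => happ (h j ^ 2) (by have := hh0 j; positivity)
  set H : ℕ → EuclideanSpace ℝ (Fin n) → ENNReal :=
    fun j => Ω.piecewise (fun x => ENNReal.ofReal (1 + ‖gradv (v j) x‖ ^ (p x + 2))) 0 with hH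
  have hpos : ∀ x ∈ Ω, 0 < p x + 2 := fun x hx => by linarith [hpη x (subset_closure hx)]
  have hHm : ∀ j, Measurable (H j) := by
    intro j
    refine ContinuousOn.measurable_piecewise ?_ continuousOn_const hΩo.measurableSet
    intro x hx
    have h1 : ContinuousWithinAt (fun y => ‖gradv (v j) y‖) Ω x :=
      ((hv j x hx).gradv.continuousAt.norm).continuousWithinAt
    have h2 : ContinuousWithinAt (fun y => p y + 2) Ω x :=
      ((hp.mono subset_closure) x hx).add continuousWithinAt_const
    have h3 := h1.rpow h2 (.inr (hpos x hx))
    exact ENNReal.continuous_ofReal.continuousAt.comp_continuousWithinAt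
      (continuousWithinAt_const.add h3)
  have hHint : ∀ j, ∫⁻ x, H j x ≤ volume Ω + D := by
    intro j
    have e1 : ∫⁻ x, H j x = ∫⁻ x in Ω, (1 + ENNReal.ofReal (‖gradv (v j) x‖ ^ (p x + 2))) := by
      rw [← lintegral_indicator hΩo.measurableSet]
      congr 1
      ext x
      by_cases hx : x ∈ Ω
      · simp only [hH, piecewise_eq_of_mem _ _ _ hx, indicator_of_mem hx]
        rw [ENNReal.ofReal_add zero_le_one (by positivity), ENNReal.ofReal_one]
      · simp [hH, hx]
    rw [e1, lintegral_add_left measurable_const]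
    gcongr
    · simp
    · exact hvD j
  set W : ℕ → EuclideanSpace ℝ (Fin n) → ENNReal :=
    fun j x => ∫⁻ s in Icc (0 : ℝ) 1, H j (x + (s * h j) • e) with hW
  have hjm : ∀ j, Measurable (Function.uncurry
      fun (x : EuclideanSpace ℝ (Fin n)) (s : ℝ) => H j (x + (s * h j) • e)) := by
    intro j
    exact (hHm j).comp (Continuous.measurable (by fun_prop))
  have hWm : ∀ j, Measurable (W j) := fun j => (hjm j).lintegral_prod_right
  have hWint : ∀ j, ∫⁻ x, W j x ≤ volume Ω + D := by
    intro j
    simp only [hW]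
    rw [lintegral_lintegral_swap (hjm j).aemeasurable]
    simp_rw [lintegral_add_right_eq_self (H j)]
    simpa using hHint j
  have hpt : ∀ x ∈ Ω, ENNReal.ofReal (|pd u i x| ^ (p x + 2))
      ≤ liminf (fun j => W j x) atTop := by
    intro x hx
    by_cases hd : DifferentiableAt ℝ u x
    swap
    · simp [pd, fderiv_zero_of_not_differentiableAt hd, Real.zero_rpow (hpos x hx).ne']
    have hlim0 := tendsto_one_div_add_atTop_nhds_zero_nat (𝕜 := ℝ)
    have hhlim : Tendsto h atTop (nhds 0) :=
      squeeze_zero (fun j => (hh0 j).le) hh1 hlim0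
    obtain ⟨ρ, hρ, hball⟩ := Metric.isOpen_iff.1 hΩo x hx
    have hev : ∀ᶠ j in atTop, ∀ s ∈ Icc (0 : ℝ) 1, x + (s * h j) • e ∈ Ω := by
      filter_upwards [hhlim.eventually (gt_mem_nhds hρ)] with j hj s hs
      apply hball
      rw [mem_ball, dist_eq_norm, add_sub_cancel_left, norm_smul, hnorm, mul_one,
        Real.norm_of_nonneg (mul_nonneg hs.1 (hh0 j).le)]
      nlinarith [hs.1, hs.2, hh0 j]
    have hquot : Tendsto (fun j => (u (x + h j • e) - u x) / h j) atTop (nhds (pd u i x)) := by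
      have hl : HasDerivAt (fun t : ℝ => u (x + t • e)) (pd u i x) 0 :=
        hd.hasFDerivAt.hasLineDerivAt e
      have h1 := hl.tendsto_slope_zero
      have h2 : Tendsto h atTop (nhdsWithin 0 {0}ᶜ) :=
        tendsto_nhdsWithin_iff.2 ⟨hhlim, Filter.Eventually.of_forall fun j => (hh0 j).ne'⟩
      refine (h1.comp h2).congr fun j => ?_
      simp
      ring
    have hquotv : Tendsto (fun j => (v j (x + h j • e) - v j x) / h j) atTop
        (nhds (pd u i x)) := by
      have hz : Tendsto (fun j => (v j (x + h j • e) - v j x) / h j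
          - (u (x + h j • e) - u x) / h j) atTop (nhds 0) := by
        have h2 : Tendsto (fun j => 2 * h j) atTop (nhds 0) := by simpa using hhlim.const_mul 2
        refine squeeze_zero_norm' ?_ h2
        filter_upwards [hev] with j hj
        have a1 := hvu j _ hx
        have a2 := hvu j _ (by simpa using hj 1 (by simp))
        rw [← sub_div, Real.norm_eq_abs, abs_div, abs_of_pos (hh0 j), div_le_iff₀ (hh0 j)]
        rw [abs_le] at *
        constructor <;> nlinarith
      simpa using hz.add hquot
    have hexp : Tendsto (fun j : ℕ => p x + 2 - η * (1 / ((j : ℝ) + 1))) atTop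
        (nhds (p x + 2)) := by
      simpa using (hlim0.const_mul η).const_sub (p x + 2)
    have hfin := ENNReal.tendsto_ofReal ((hquotv.abs).rpow hexp (.inr (hpos x hx)))
    rw [← hfin.liminf_eq]
    refine liminf_le_liminf ?_ (by isBoundedDefault) (by isBoundedDefault)
    filter_upwards [hev] with j hj
    have hj1 : 1 / ((j : ℝ) + 1) ≤ 1 := by
      rw [div_le_one (by positivity)]
      linarith [(Nat.cast_nonneg j : (0:ℝ) ≤ j)]
    have hpx := hpη x (subset_closure hx)
    have hηj : η * (1 / ((j : ℝ) + 1)) ≤ η := by nlinarith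
    have hr : 1 ≤ p x + 2 - η * (1 / ((j : ℝ) + 1)) := by linarith
    refine (ofReal_abs_slope_rpow_le (hh0 j) hr fun s hs => hv j _ (hj s hs)).trans ?_
    refine setLIntegral_mono' measurableSet_Icc fun s hs => ?_
    have hy := hj s hs
    simp only [hH, piecewise_eq_of_mem _ _ _ hy]
    apply ENNReal.ofReal_le_ofReal
    set y := x + (s * h j) • e with hydef
    have hdist : dist x y ≤ h j := by
      rw [dist_comm, dist_eq_norm, hydef, add_sub_cancel_left, norm_smul, hnorm, mul_one,
        Real.norm_of_nonneg (mul_nonneg hs.1 (hh0 j).le)]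
      nlinarith [hs.1, hs.2, hh0 j]
    have hpp := (abs_le.1 (hhp j x (subset_closure hx) y (subset_closure hy) hdist)).2
    have hle : |pd (v j) i y| ≤ ‖gradv (v j) y‖ := by
      have := PiLp.norm_apply_le (gradv (v j) y) i
      rwa [gradv_apply, Real.norm_eq_abs] at this
    rcases le_total (|pd (v j) i y|) 1 with h1 | h1
    · have := Real.rpow_le_one (abs_nonneg _) h1 (by linarith :
        0 ≤ p x + 2 - η * (1 / ((j : ℝ) + 1)))
      have h2 : 0 ≤ ‖gradv (v j) y‖ ^ (p y + 2) := by positivity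
      linarith
    · calc |pd (v j) i y| ^ (p x + 2 - η * (1 / ((j : ℝ) + 1)))
          ≤ |pd (v j) i y| ^ (p y + 2) :=
            Real.rpow_le_rpow_of_exponent_le h1 (by linarith)
        _ ≤ ‖gradv (v j) y‖ ^ (p y + 2) :=
            Real.rpow_le_rpow (abs_nonneg _) hle (hpos y hy).le
        _ ≤ _ := by linarith
  calc ∫⁻ x in Ω, ENNReal.ofReal (|pd u i x| ^ (p x + 2))
      ≤ ∫⁻ x in Ω, liminf (fun j => W j x) atTop := setLIntegral_mono' hΩo.measurableSet hpt
    _ ≤ ∫⁻ x, liminf (fun j => W j x) atTop := setLIntegral_le_lintegral _ _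
    _ ≤ liminf (fun j => ∫⁻ x, W j x) atTop := lintegral_liminf_le hWm
    _ ≤ volume Ω + D := by
        refine liminf_le_of_le (by isBoundedDefault) fun b hb => ?_
        obtain ⟨j, hj⟩ := hb.exists
        exact hj.trans (hWint j)

/-- The modular of the gradient is controlled by those of the partial derivatives. -/
lemma ofReal_norm_gradv_rpow_le_sum {n : ℕ} (hn : 0 < n) (u : EuclideanSpace ℝ (Fin n) → ℝ)
    (x : EuclideanSpace ℝ (Fin n)) {q Q : ℝ} (hq : 0 ≤ q) (hqQ : q ≤ Q) :
    ENNReal.ofReal (‖gradv u x‖ ^ q)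
      ≤ ∑ i, ENNReal.ofReal ((n : ℝ) ^ Q) * ENNReal.ofReal (|pd u i x| ^ q) := by
  have hne : (Finset.univ : Finset (Fin n)).Nonempty := ⟨⟨0, hn⟩, Finset.mem_univ _⟩
  obtain ⟨i, -, hi⟩ := Finset.exists_max_image Finset.univ (fun i => |pd u i x|) hne
  have hn1 : (1 : ℝ) ≤ n := by exact_mod_cast hn
  have h1 : ‖gradv u x‖ ≤ n * |pd u i x| := by
    have h2 : ‖gradv u x‖ ^ 2 ≤ (n * |pd u i x|) ^ 2 := by
      rw [norm_gradv_sq]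
      calc ∑ j, pd u j x * pd u j x ≤ ∑ _j : Fin n, |pd u i x| ^ 2 := by
            refine Finset.sum_le_sum fun j hj => ?_
            rw [← sq, ← sq_abs]
            exact pow_le_pow_left₀ (abs_nonneg _) (hi j hj) 2
        _ = n * |pd u i x| ^ 2 := by simp
        _ ≤ (n * |pd u i x|) ^ 2 := by
            rw [mul_pow]
            gcongr
            nlinarith
    exact le_of_sq_le_sq h2 (by positivity)
  refine le_trans ?_ (Finset.single_le_sum (fun j _ => zero_le) (Finset.mem_univ i))
  rw [← ENNReal.ofReal_mul (by positivity)]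
  apply ENNReal.ofReal_le_ofReal
  calc ‖gradv u x‖ ^ q ≤ (n * |pd u i x|) ^ q := Real.rpow_le_rpow (norm_nonneg _) h1 hq
    _ = (n : ℝ) ^ q * |pd u i x| ^ q := Real.mul_rpow (by positivity) (abs_nonneg _)
    _ ≤ _ := by
        gcongr

lemma measurable_pd {n : ℕ} (u : EuclideanSpace ℝ (Fin n) → ℝ) (i : Fin n) :
    Measurable (pd u i) := measurable_fderiv_apply_const ℝ u _

lemma integral_le_toReal_of_lintegral_le {X : Type*} [MeasurableSpace X] {μ : Measure X}
    {f : X → ℝ} (hf : ∀ x, 0 ≤ f x) {D : ENNReal} (hD : D ≠ ⊤)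
    (h : ∫⁻ x, ENNReal.ofReal (f x) ∂μ ≤ D) : ∫ x, f x ∂μ ≤ D.toReal := by
  by_cases hi : Integrable f μ
  · rw [integral_eq_lintegral_of_nonneg_ae (Filter.Eventually.of_forall hf)
      hi.aestronglyMeasurable]
    exact ENNReal.toReal_mono hD h
  · rw [integral_undef hi]
    exact ENNReal.toReal_nonneg

lemma exists_norm_gradv_le {n : ℕ} {S U : Set (EuclideanSpace ℝ (Fin n))} (hS : IsCompact S)
    (hU : IsOpen U) (hSU : S ⊆ U) {g : EuclideanSpace ℝ (Fin n) → ℝ}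
    (hg : ContDiffOn ℝ 1 g U) : ∃ G : ℝ, 0 ≤ G ∧ ∀ x ∈ S, ‖gradv g x‖ ≤ G := by
  have hc : ContinuousOn (fun x => gradv g x) U := by
    have h1 := hg.continuousOn_fderiv_of_isOpen hU le_rfl
    refine (PiLp.continuous_toLp 2 _).comp_continuousOn (continuousOn_pi.2 fun i => ?_)
    exact h1.clm_apply continuousOn_const
  obtain ⟨G, hG⟩ := hS.exists_bound_of_continuousOn (hc.mono hSU)
  exact ⟨max G 0, le_max_right _ _, fun x hx => (hG x hx).trans (le_max_left _ _)⟩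

/-- Lemma 4.2: uniform-in-ε bound on `∫_Ω |∇u_ε|^{p(x)+2} dx`. -/
theorem stmt11
    (n : ℕ) (hn : 0 < n)
    (Ω : Set (EuclideanSpace ℝ (Fin n)))
    (hΩo : IsOpen Ω) (hΩconn : IsConnected Ω)
    (hΩbd : Bornology.IsBounded Ω) (hΩsph : ExteriorSphereCond Ω)
    (T : ℝ) (hT : 0 < T)
    (γ : ℝ) (hγ : γ ∈ Ioo (0:ℝ) 1)
    (p : EuclideanSpace ℝ (Fin n) → ℝ)
    (hp : C1HolderOn γ (closure Ω) p)
    (hp1 : ∀ x ∈ closure Ω, -1 < p x)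
    (ε₀ : ℝ) (hε₀ : 0 < ε₀)
    (ψ u₀ : EuclideanSpace ℝ (Fin n) → ℝ)
    (U : Set (EuclideanSpace ℝ (Fin n))) (hU : IsOpen U) (hUΩ : closure Ω ⊆ U)
    (hu₀ : ContDiffOn ℝ 1 u₀ U)
    (hu₀ψ : ∀ x ∈ frontier Ω, u₀ x = ψ x)
    (M K : ℝ) (hM : 0 < M) (hK : 0 < K)
    (α β : ℝ) (hα : 0 < α) (hβ : 0 < β)
    (pt : ℝ) (hpt : -1 < pt)
    (hpt2 : ∀ x ∈ closure Ω, pt < p x)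
    (f : EuclideanSpace ℝ (Fin n) → ℝ → EuclideanSpace ℝ (Fin n) → ℝ)
    (f₀ : EuclideanSpace ℝ (Fin n) → ℝ → ℝ)
    (hf : ∀ x ∈ closure Ω, ∀ v : ℝ, ∀ z : EuclideanSpace ℝ (Fin n),
      |f x v z| ≤ α * ‖z‖ ^ (pt + 2) + β)
    (hf₀c : ContinuousOn (fun q : EuclideanSpace ℝ (Fin n) × ℝ => f₀ q.1 q.2)
      (closure Ω ×ˢ Icc (-M) M))
    (hf₀b : ∃ Cf : ℝ, ∀ x ∈ closure Ω, ∀ v ∈ Icc (-M) M, |f₀ x v| ≤ Cf) :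
    ∃ C : ℝ, ∀ ε ∈ Ioc (0:ℝ) ε₀,
      ∀ u : ℝ → EuclideanSpace ℝ (Fin n) → ℝ,
        IsClassicalSolIso Ω T p
          (fun x v z => f x v z + f₀ x v) ψ u₀ ε u →
        (∀ t ∈ Icc 0 T, ∀ x ∈ closure Ω, |u t x| ≤ M) →
        (∀ t ∈ Ioo 0 T, ∀ x ∈ Ω, |deriv (fun s => u s x) t| ≤ K) →
      ∀ t ∈ Icc 0 T, (∫ x in Ω, ‖gradv (u t) x‖ ^ (p x + 2)) ≤ C := by
  have hcomp := hΩbd.isCompact_closure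
  have hsub : Ω ⊆ closure Ω := subset_closure
  have hpc : ContinuousOn p (closure Ω) := hp.1.continuousOn
  have hpd : ∀ x ∈ Ω, ContDiffAt ℝ 1 p x := fun x hx =>
    (hp.1.mono hsub).contDiffAt (hΩo.mem_nhds hx)
  have hvol : volume Ω ≠ ⊤ := hΩbd.measure_lt_top.ne
  have hfr : ∀ x ∈ frontier Ω, x ∈ closure Ω := fun x hx => frontier_subset_closure hx
  obtain ⟨η, P, hη, hpη, hptη, hpP⟩ : ∃ η P : ℝ, 0 < η ∧ (∀ x ∈ closure Ω, -1 + η ≤ p x) ∧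
      (∀ x ∈ closure Ω, pt + η ≤ p x) ∧ ∀ x ∈ closure Ω, p x ≤ P := by
    have hne : (closure Ω).Nonempty := hΩconn.nonempty.closure
    obtain ⟨a, ha, hamin⟩ := hcomp.exists_isMinOn hne hpc
    obtain ⟨b, hb, hbmax⟩ := hcomp.exists_isMaxOn hne hpc
    refine ⟨min (p a + 1) (p a - pt), p b,
      lt_min (by linarith [hp1 a ha]) (by linarith [hpt2 a ha]), ?_, ?_, fun x hx => hbmax hx⟩
    · intro x hx
      have h1 : p a ≤ p x := hamin hx
      linarith [min_le_left (p a + 1) (p a - pt)]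
    · intro x hx
      have h1 : p a ≤ p x := hamin hx
      linarith [min_le_right (p a + 1) (p a - pt)]
  obtain ⟨Cf, hCf⟩ := hf₀b
  have hcomparison : ∀ g : EuclideanSpace ℝ (Fin n) → ℝ, ContDiffOn ℝ 1 g U →
      (∀ x ∈ frontier Ω, g x = ψ x) → ∃ C : ℝ, ∀ ε ∈ Ioc (0:ℝ) ε₀,
      ∀ u : ℝ → EuclideanSpace ℝ (Fin n) → ℝ,
        IsClassicalSolIso Ω T p (fun x v z => f x v z + f₀ x v) ψ u₀ ε u →
        (∀ t ∈ Icc 0 T, ∀ x ∈ closure Ω, |u t x| ≤ M) →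
        (∀ t ∈ Ioo 0 T, ∀ x ∈ Ω, |deriv (fun s => u s x) t| ≤ K) →
      ∀ t ∈ Ioo 0 T, ∫⁻ x in Ω ∩ {x | u t x ≠ g x},
        ENNReal.ofReal (‖gradv (u t) x‖ ^ (p x + 2)) ≤ ENNReal.ofReal C := by
    intro g hgU hgψ
    have hgc : ContinuousOn g (closure Ω) := hgU.continuousOn.mono hUΩ
    obtain ⟨G, hG0, hG⟩ := exists_norm_gradv_le hcomp hU hUΩ hgU
    obtain ⟨M', hM'⟩ := hcomp.exists_bound_of_continuousOn hgc
    set m := M + |M'| with hm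
    have hm0 : 0 ≤ m := by positivity
    obtain ⟨c, C, hc, hC, hcoer⟩ := exists_coercivity (P := P) hη hpt hG0
      (mul_nonneg hm0 hα.le) hε₀
    refine ⟨(C + m * (K + β + |Cf|)) / c * volume.real Ω, ?_⟩
    intro ε hε u hu huM huK t ht
    have ht' : t ∈ Icc 0 T := Ioo_subset_Icc_self ht
    have hvc : ContinuousOn (u t) (closure Ω) :=
      hu.cont.comp (f := fun x : EuclideanSpace ℝ (Fin n) => (t, x)) (by fun_prop)
        fun x hx => ⟨ht', hx⟩
    refine setLIntegral_norm_gradv_rpow_le (α := α) (pt := pt) hΩo hΩbd hvc (hu.smooth_x t ht) hgc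
      (fun x hx => hgU.contDiffAt (hU.mem_nhds (hUΩ (hsub hx)))) hpd
      (fun x hx => by rw [hu.bdry t ht x hx, hgψ x hx]) (fun x hx => hG x (hsub hx)) hm0 ?_ hε.1
      (by positivity) hc hC ?_ ?_
    · intro x hx
      have h1 := huM t ht' x (hsub hx)
      have h2 := hM' x (hsub hx)
      rw [Real.norm_eq_abs] at h2
      calc |u t x - g x| ≤ |u t x| + |g x| := abs_sub _ _
        _ ≤ M + |M'| := add_le_add h1 (h2.trans (le_abs_self _))
    · intro x hx
      have h1 := abs_le.1 (huK t ht x hx)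
      have h2 := abs_le.1 (hf x (hsub hx) (u t x) (gradv (u t) x))
      have h3 := abs_le.1 (hCf x (hsub hx) (u t x) (abs_le.1 (huM t ht' x (hsub hx))))
      have h4 := hu.eqn t ht x hx
      have h5 := le_abs_self Cf
      rw [abs_le]
      constructor <;> linarith
    · intro x hx r hr
      exact hcoer (p x) r ε (hpη x (hsub hx)) (hpP x (hsub hx)) (hptη x (hsub hx)) hε.1 hε.2 hr
  obtain ⟨ζ, hζsupp, hζ, -⟩ := hΩo.exists_contDiff_support_eq (n := 1)
  have hζ0 : ∀ x, ζ x ≠ 0 ↔ x ∈ Ω := fun x => by rw [← hζsupp]; rfl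
  obtain ⟨C₁, hC₁⟩ := hcomparison u₀ hu₀ hu₀ψ
  obtain ⟨C₂, hC₂⟩ := hcomparison (fun x => u₀ x + ζ x) (hu₀.add hζ.contDiffOn) (by
    intro x hx
    have : ζ x = 0 := by
      by_contra hcon
      rw [frontier, hΩo.interior_eq] at hx
      exact hx.2 ((hζ0 x).1 hcon)
    rw [this, add_zero, hu₀ψ x hx])
  obtain ⟨G, hG0, hG⟩ := exists_norm_gradv_le hcomp hU hUΩ hu₀
  set D : ENNReal := ENNReal.ofReal C₁ + ENNReal.ofReal C₂ with hD
  set D₀ : ENNReal := ENNReal.ofReal (max 1 G ^ (P + 2)) * volume Ω with hD₀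
  set D₁ : ENNReal := ∑ _i : Fin n, ENNReal.ofReal ((n : ℝ) ^ (P + 2)) * (volume Ω + D) with hD₁
  have hDtop : D ≠ ⊤ := by simp [hD]
  have htop : D + D₀ + D₁ ≠ ⊤ := by
    have h0 : D₀ ≠ ⊤ := ENNReal.mul_ne_top ENNReal.ofReal_ne_top hvol
    have h1 : D₁ ≠ ⊤ := ENNReal.sum_ne_top.2 fun i _ =>
      ENNReal.mul_ne_top ENNReal.ofReal_ne_top (ENNReal.add_ne_top.2 ⟨hvol, hDtop⟩)
    exact ENNReal.add_ne_top.2 ⟨ENNReal.add_ne_top.2 ⟨hDtop, h0⟩, h1⟩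
  refine ⟨(D + D₀ + D₁).toReal, ?_⟩
  intro ε hε u hu huM huK t ht
  refine integral_le_toReal_of_lintegral_le (fun x => by positivity) htop ?_
  have hinner : ∀ t ∈ Ioo 0 T,
      ∫⁻ x in Ω, ENNReal.ofReal (‖gradv (u t) x‖ ^ (p x + 2)) ≤ D := by
    intro t ht
    have hcover : Ω ⊆ (Ω ∩ {x | u t x ≠ u₀ x}) ∪ (Ω ∩ {x | u t x ≠ u₀ x + ζ x}) := by
      intro x hx
      by_cases h : u t x = u₀ x
      · right
        refine ⟨hx, fun h' => (hζ0 x).2 hx ?_⟩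
        have h'' : u t x = u₀ x + ζ x := h'
        linarith
      · exact .inl ⟨hx, h⟩
    exact ((lintegral_mono_set hcover).trans (lintegral_union_le _ _ _)).trans
      (add_le_add (hC₁ ε hε u hu huM huK t ht) (hC₂ ε hε u hu huM huK t ht))
  rcases eq_or_lt_of_le ht.1 with h0 | h0
  · subst h0
    refine le_trans ?_ (le_add_right (le_add_left (le_refl D₀)))
    calc ∫⁻ x in Ω, ENNReal.ofReal (‖gradv (u 0) x‖ ^ (p x + 2))
        ≤ ∫⁻ _x in Ω, ENNReal.ofReal (max 1 G ^ (P + 2)) := by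
          refine setLIntegral_mono' hΩo.measurableSet fun x hx => ENNReal.ofReal_le_ofReal ?_
          have heq : u 0 =ᶠ[nhds x] u₀ := by
            filter_upwards [hΩo.mem_nhds hx] with y hy
            exact hu.init y (hsub hy)
          have hgr : gradv (u 0) x = gradv u₀ x := by
            ext i
            simp only [gradv_apply, pd]
            rw [heq.fderiv_eq]
          rw [hgr]
          calc ‖gradv u₀ x‖ ^ (p x + 2) ≤ max 1 G ^ (p x + 2) :=
                Real.rpow_le_rpow (norm_nonneg _) ((hG x (hsub hx)).trans (le_max_right _ _))
                  (by linarith [hp1 x (hsub hx)])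
            _ ≤ _ := Real.rpow_le_rpow_of_exponent_le (le_max_left _ _)
                  (by linarith [hpP x (hsub hx)])
      _ = D₀ := by rw [setLIntegral_const]
  rcases eq_or_lt_of_le ht.2 with h1 | h1
  swap
  · exact (hinner t ⟨h0, h1⟩).trans (le_add_right le_self_add)
  subst h1
  refine le_trans ?_ (le_add_left (le_refl D₁))
  have hpart := setLIntegral_pd_rpow_le_of_approx (u := u t) (D := D) hΩo hΩbd hpc hη hpη (by
    intro κ hκ
    have huc := ((isCompact_Icc (a := 0) (b := t)).prod hcomp).uniformContinuousOn_of_continuous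
      hu.cont
    rw [Metric.uniformContinuousOn_iff] at huc
    obtain ⟨d, hd, hd2⟩ := huc κ hκ
    obtain ⟨s, hs1, hs2⟩ := exists_between (max_lt h0 (sub_lt_self t hd))
    rw [max_lt_iff] at hs1
    have hs : s ∈ Ioo 0 t := ⟨hs1.1, hs2⟩
    refine ⟨u s, hu.smooth_x s hs, fun x hx => ?_, hinner s hs⟩
    have := hd2 (s, x) ⟨Ioo_subset_Icc_self hs, hsub hx⟩ (t, x) ⟨ht, hsub hx⟩ (by
      rw [Prod.dist_eq, dist_self, Real.dist_eq, max_lt_iff, abs_lt]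
      exact ⟨⟨by linarith, by linarith⟩, hd⟩)
    exact this.le)
  have hmeas : ∀ i, AEMeasurable (fun x => ENNReal.ofReal (|pd (u t) i x| ^ (p x + 2)))
      (volume.restrict Ω) := by
    intro i
    have h2 : AEMeasurable p (volume.restrict Ω) :=
      (hpc.mono hsub).aemeasurable hΩo.measurableSet
    exact (((measurable_pd (u t) i).abs.aemeasurable).pow (h2.add_const 2)).ennreal_ofReal
  calc ∫⁻ x in Ω, ENNReal.ofReal (‖gradv (u t) x‖ ^ (p x + 2))
      ≤ ∫⁻ x in Ω, ∑ i, ENNReal.ofReal ((n : ℝ) ^ (P + 2)) *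
          ENNReal.ofReal (|pd (u t) i x| ^ (p x + 2)) :=
        setLIntegral_mono' hΩo.measurableSet fun x hx =>
          ofReal_norm_gradv_rpow_le_sum hn (u t) x (by linarith [hp1 x (hsub hx)])
            (by linarith [hpP x (hsub hx)])
    _ = ∑ i, ENNReal.ofReal ((n : ℝ) ^ (P + 2)) *
          ∫⁻ x in Ω, ENNReal.ofReal (|pd (u t) i x| ^ (p x + 2)) := by
        rw [lintegral_finsetSum' _ fun i _ => (hmeas i).const_mul _]
        exact Finset.sum_congr rfl fun i _ => lintegral_const_mul'' _ (hmeas i)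
    _ ≤ D₁ := by
        rw [hD₁]
        gcongr with i
        exact hpart i
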